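/- Let p be a prime and n a positive integer with p ≥ 2n. Let M be a nilpotent n×n matrix over Z_p, let B ∈ M_n(Z_p) be arbitrary, and set A := exp(M) + p·B, where exp(M) := ∑_{i=0}^{n-1} M^i / i!. Then A^p ≡ 1 + p·M (mod p²), i.e., every entry of A^p − 1 − p·M is divisible by p². -/

import Mathlib

/-- The truncated exponential `exp M = ∑_{i<n} M^i / i!` of an `n × n` matrix over `ℤ_p`
(the factorials `i!` for `i < n ≤ p` are units of `ℤ_p`, inverted via `Ring.inverse`). -/
noncomputable def truncExpZp (p n : ℕ) [Fact p.Prime]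
    (M : Matrix (Fin n) (Fin n) ℤ_[p]) : Matrix (Fin n) (Fin n) ℤ_[p] :=
  ∑ i ∈ Finset.range n, (Ring.inverse (Nat.factorial i : ℤ_[p])) • M ^ i

theorem CharP.cast_choose_sub_one (R : Type*) [Ring R] (p : ℕ) [hp : Fact p.Prime] [CharP R p]
    {k : ℕ} (hk : k < p) : ((p - 1).choose k : R) = (-1) ^ k := by
  induction k with
  | zero => simp
  | succ k ih =>
    have h := Nat.choose_succ_succ (p - 1) k
    rw [Nat.succ_eq_add_one, Nat.sub_add_cancel hp.out.one_le] at h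
    have h0 : (p.choose (k + 1) : R) = 0 :=
      (CharP.cast_eq_zero_iff R p _).2 (hp.out.dvd_choose_self k.succ_ne_zero hk)
    rw [h, Nat.cast_add, ih (by lia)] at h0
    rw [pow_succ, mul_neg_one]
    exact eq_neg_of_add_eq_zero_right h0

theorem Commute.geom_sum₂_eq_sub_pow {R : Type*} [Ring R] (p : ℕ) [hp : Fact p.Prime] [CharP R p]
    {x y : R} (h : Commute x y) :
    ∑ i ∈ Finset.range p, x ^ i * y ^ (p - 1 - i) = (x - y) ^ (p - 1) := by
  rw [sub_eq_add_neg, h.neg_right.add_pow, Nat.sub_add_cancel hp.out.one_le]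
  refine Finset.sum_congr rfl fun i hi => ?_
  have hi := Finset.mem_range.1 hi
  rw [← Nat.choose_symm (by lia : i ≤ p - 1), CharP.cast_choose_sub_one R p (by lia), neg_pow y,
    ((Commute.neg_one_left y).pow_pow _ _).eq, mul_assoc, mul_assoc, ← (Commute.refl (-1 : R)).mul_pow]
  simp

theorem exists_add_smul_pow_eq {R S : Type*} [CommRing R] [Ring S] [Algebra R S] (c : R)
    (a b : S) (k : ℕ) :
    ∃ d, (a + c • b) ^ k =
      a ^ k + c • ∑ i ∈ Finset.range k, a ^ i * b * a ^ (k - 1 - i) + c ^ 2 • d := by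
  induction k with
  | zero => exact ⟨0, by simp⟩
  | succ k ih =>
    obtain ⟨d, hd⟩ := ih
    have hs : ∑ i ∈ Finset.range (k + 1), a ^ i * b * a ^ (k + 1 - 1 - i) =
        (∑ i ∈ Finset.range k, a ^ i * b * a ^ (k - 1 - i)) * a + a ^ k * b := by
      rw [Finset.sum_range_succ, Finset.sum_mul]
      congr 1
      · refine Finset.sum_congr rfl fun i hi => ?_
        have hi := Finset.mem_range.1 hi
        rw [mul_assoc _ _ a, ← pow_succ, show k - 1 - i + 1 = k + 1 - 1 - i by lia]
      · simp
    refine ⟨(∑ i ∈ Finset.range k, a ^ i * b * a ^ (k - 1 - i)) * b + d * (a + c • b), ?_⟩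
    rw [pow_succ, hd, hs]
    simp only [add_mul, mul_add, smul_mul_assoc, mul_smul_comm, smul_add, smul_smul, pow_succ a k]
    module

theorem sum_pow_mul_mul_pow_eq_zero {R S : Type*} [CommRing R] [Ring S] [Algebra R S] (p : ℕ)
    [hp : Fact p.Prime] [CharP S p] {n : ℕ} (hpn : 2 * n ≤ p) {a : S} (ha : (a - 1) ^ n = 0)
    (b : S) : ∑ i ∈ Finset.range p, a ^ i * b * a ^ (p - 1 - i) = 0 := by
  have : Nontrivial S := CharP.nontrivial_of_char_ne_one (R := S) hp.out.ne_one
  have : CharP (Module.End R S) p := by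
    refine (CharP.charP_iff_prime_eq_zero hp.out).2 (LinearMap.ext fun x => ?_)
    simp
  set L : Module.End R S := LinearMap.mulLeft R a
  set Q : Module.End R S := LinearMap.mulRight R a
  have hL : (L - 1) ^ n = 0 := by
    have : L - 1 = LinearMap.mulLeft R (a - 1) := by ext; simp [L, sub_mul]
    rw [this, LinearMap.pow_mulLeft, ha, LinearMap.mulLeft_zero_eq_zero]
  have hQ : (-(Q - 1)) ^ n = 0 := by
    have : Q - 1 = LinearMap.mulRight R (a - 1) := by ext; simp [Q, mul_sub]
    rw [neg_pow (Q - 1 : Module.End R S), this, LinearMap.pow_mulRight, ha,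
      LinearMap.mulRight_zero_eq_zero, mul_zero]
  have hc : Commute L Q := LinearMap.commute_mulLeft_right a a
  have hc' : Commute (L - 1) (-(Q - 1)) :=
    ((hc.sub_left (Commute.one_left _)).sub_right (Commute.one_right _)).neg_right
  have h0 : (L - Q) ^ (p - 1) = 0 := by
    rw [show L - Q = (L - 1) + -(Q - 1) by abel]
    exact hc'.add_pow_eq_zero_of_add_le_succ_of_pow_eq_zero hL hQ (by have := hp.out.one_le; lia)
  rw [← hc.geom_sum₂_eq_sub_pow p] at h0
  have := LinearMap.congr_fun h0 b
  simpa [L, Q, LinearMap.pow_mulLeft, LinearMap.pow_mulRight, mul_assoc] using this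

theorem IsNilpotent.exp_nsmul {A : Type*} [Ring A] [Module ℚ A] {a : A} (ha : IsNilpotent a)
    (k : ℕ) : IsNilpotent.exp (k • a) = IsNilpotent.exp a ^ k := by
  induction k with
  | zero => simp
  | succ k ih =>
    rw [succ_nsmul, IsNilpotent.exp_add_of_commute ((Commute.refl a).smul_left k)
      (ha.smul k) ha, ih, _root_.pow_succ]

theorem Matrix.pow_card_eq_zero_of_isNilpotent {R m : Type*} [CommRing R] [IsDomain R]
    [Fintype m] [DecidableEq m] {M : Matrix m m R} (hM : IsNilpotent M) :
    M ^ Fintype.card m = 0 := by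
  have h := (Matrix.isNilpotent_charpoly_sub_pow_of_isNilpotent hM).eq_zero
  simpa [sub_eq_zero.1 h] using Matrix.aeval_self_charpoly M

section

variable {p n : ℕ} [hp : Fact p.Prime]

theorem PadicInt.isUnit_natCast_factorial {i : ℕ} (hi : i < p) :
    IsUnit (i.factorial : ℤ_[p]) := by
  rw [PadicInt.isUnit_iff, PadicInt.norm_natCast_eq_one_iff]
  exact ((hp.out.coprime_iff_not_dvd).2 fun h => by
    have := (hp.out.dvd_factorial).1 h
    lia)

theorem map_truncExpZp (hpn : n ≤ p) {M : Matrix (Fin n) (Fin n) ℤ_[p]} (hM : M ^ n = 0) :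
    (PadicInt.Coe.ringHom (p := p)).mapMatrix (truncExpZp p n M) =
      IsNilpotent.exp ((PadicInt.Coe.ringHom (p := p)).mapMatrix M) := by
  have h : ((PadicInt.Coe.ringHom (p := p)).mapMatrix M) ^ n = 0 := by
    rw [← map_pow, hM, map_zero]
  rw [IsNilpotent.exp_eq_sum h, truncExpZp, map_sum]
  refine Finset.sum_congr rfl fun i hi => ?_
  have hu := PadicInt.isUnit_natCast_factorial (p := p) ((Finset.mem_range.1 hi).trans_le hpn)
  have hi : (PadicInt.Coe.ringHom (p := p)) (Ring.inverse (i.factorial : ℤ_[p])) =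
      (i.factorial : ℚ_[p])⁻¹ := by
    refine eq_inv_of_mul_eq_one_left ?_
    rw [← map_natCast (PadicInt.Coe.ringHom (p := p)), ← map_mul, Ring.inverse_mul_cancel _ hu,
      map_one]
  rw [← map_pow]
  ext j k
  simp only [RingHom.mapMatrix_apply, Matrix.map_apply, Matrix.smul_apply, smul_eq_mul, map_mul, hi,
    Rat.smul_def]
  push_cast
  rfl

theorem truncExpZp_pow (hpn : n ≤ p) {M : Matrix (Fin n) (Fin n) ℤ_[p]} (hM : M ^ n = 0) (k : ℕ) :
    truncExpZp p n M ^ k = truncExpZp p n (k • M) := by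
  have hk : (k • M) ^ n = 0 := by rw [smul_pow, hM, smul_zero]
  have hinj : Function.Injective ((PadicInt.Coe.ringHom (p := p)).mapMatrix (m := Fin n)) :=
    Matrix.map_injective Subtype.val_injective
  apply hinj
  rw [map_pow, map_truncExpZp hpn hM, map_truncExpZp hpn hk, map_nsmul, IsNilpotent.exp_nsmul]
  exact ⟨n, by rw [← map_pow, hM, map_zero]⟩

theorem truncExpZp_eq_add {M : Matrix (Fin n) (Fin n) ℤ_[p]} (hM : M ^ n = 0) :
    truncExpZp p n M = 1 + M +
      ∑ i ∈ Finset.Ico 2 n, (Ring.inverse (i.factorial : ℤ_[p])) • M ^ i := by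
  rcases n with _ | _ | n
  · exact Subsingleton.elim _ _
  · have hM : M = 0 := by simpa using hM
    simp [truncExpZp, hM]
  · rw [truncExpZp, Finset.range_eq_Ico, Finset.sum_eq_sum_Ico_succ_bot (by lia),
      Finset.sum_eq_sum_Ico_succ_bot (by lia)]
    simp [add_assoc]

theorem exists_truncExpZp_prime_nsmul {M : Matrix (Fin n) (Fin n) ℤ_[p]} (hM : M ^ n = 0) :
    ∃ D, truncExpZp p n (p • M) = 1 + (p : ℤ_[p]) • M + (p : ℤ_[p]) ^ 2 • D := by
  have hpM : (p • M) ^ n = 0 := by rw [smul_pow, hM, smul_zero]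
  refine ⟨∑ i ∈ Finset.Ico 2 n,
    ((p : ℤ_[p]) ^ (i - 2) * Ring.inverse (i.factorial : ℤ_[p])) • M ^ i, ?_⟩
  rw [truncExpZp_eq_add hpM, Finset.smul_sum, Nat.cast_smul_eq_nsmul]
  congr 1
  refine Finset.sum_congr rfl fun i hi => ?_
  have hi := (Finset.mem_Ico.1 hi).1
  rw [← Nat.cast_smul_eq_nsmul ℤ_[p], smul_pow, smul_smul, smul_smul, ← mul_assoc, ← pow_add,
    Nat.add_sub_cancel' hi, mul_comm]

theorem truncExpZp_sub_one_pow (hn : 0 < n) {M : Matrix (Fin n) (Fin n) ℤ_[p]} (hM : M ^ n = 0) :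
    (truncExpZp p n M - 1) ^ n = 0 := by
  obtain ⟨n, rfl⟩ := Nat.exists_eq_add_of_le' hn
  have h : truncExpZp p (n + 1) M - 1 =
      M * ∑ i ∈ Finset.range n, (Ring.inverse ((i + 1).factorial : ℤ_[p])) • M ^ i := by
    rw [truncExpZp, Finset.sum_range_succ', Finset.mul_sum]
    simp [pow_succ']
  have hc : Commute M
      (∑ i ∈ Finset.range n, (Ring.inverse ((i + 1).factorial : ℤ_[p])) • M ^ i) :=
    Commute.sum_right _ _ _ fun i _ => ((Commute.refl M).pow_right i).smul_right _
  rw [h, hc.mul_pow, hM, zero_mul]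

theorem PadicInt.toZMod_eq_zero_iff {x : ℤ_[p]} : PadicInt.toZMod x = 0 ↔ (p : ℤ_[p]) ∣ x := by
  rw [← RingHom.mem_ker, PadicInt.ker_toZMod, PadicInt.maximalIdeal_eq_span_p,
    Ideal.mem_span_singleton]

end

/-- Let `p ≥ 2n` be prime, `M` a nilpotent `n × n` matrix over `ℤ_p`, and `B` arbitrary.
Then `A := exp M + p • B` satisfies `A^p ≡ 1 + p • M (mod p²)`. -/
theorem exp_plus_pB_pow_p (p n : ℕ) [hp : Fact p.Prime] (hn : 0 < n) (hpn : 2 * n ≤ p)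
    (M : Matrix (Fin n) (Fin n) ℤ_[p]) (hM : IsNilpotent M)
    (B : Matrix (Fin n) (Fin n) ℤ_[p]) :
    ∀ i j : Fin n,
      (p : ℤ_[p]) ^ 2 ∣
        (((truncExpZp p n M + (p : ℤ_[p]) • B) ^ p - 1 - (p : ℤ_[p]) • M) i j) := by
  have hMn : M ^ n = 0 := by simpa using Matrix.pow_card_eq_zero_of_isNilpotent hM
  obtain ⟨C, hC⟩ := exists_add_smul_pow_eq (p : ℤ_[p]) (truncExpZp p n M) B p
  obtain ⟨D, hD⟩ := exists_truncExpZp_prime_nsmul hMn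
  set T := ∑ i ∈ Finset.range p, truncExpZp p n M ^ i * B * truncExpZp p n M ^ (p - 1 - i)
    with hT
  have : NeZero n := ⟨hn.ne'⟩
  have hT0 : (PadicInt.toZMod (p := p)).mapMatrix T = 0 := by
    simp only [hT, map_sum, map_mul, map_pow]
    refine sum_pow_mul_mul_pow_eq_zero (R := ZMod p) p hpn ?_ _
    rw [← map_one (PadicInt.toZMod (p := p)).mapMatrix, ← map_sub, ← map_pow,
      truncExpZp_sub_one_pow hn hMn, map_zero]
  intro i j
  obtain ⟨t, ht⟩ : (p : ℤ_[p]) ∣ T i j :=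
    PadicInt.toZMod_eq_zero_iff.1 (congrFun (congrFun hT0 i) j)
  refine ⟨t + C i j + D i j, ?_⟩
  rw [hC, truncExpZp_pow (by lia) hMn, hD]
  simp only [Matrix.sub_apply, Matrix.add_apply, Matrix.smul_apply, smul_eq_mul, ht]
  ring
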